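/- Let α > 2, P_t > 0, σ_S² > 0, σ_P² > 0, β_e > 0, β_t > 0, ε ∈ (0,1), and λ_e > λ_e^* := (α/(2π·Γ(2/α)))·log(1/ε)·(P_t/(σ_S²β_e))^{−2/α}. With A, G, H(d) and F(d) := A − Γ(2/α, H(d)) defined as in Theorem 1 of the paper, there exists a unique d^* > 0 such that F(d^*) = 0; moreover F(d) < 0 for all 0 < d < d^* and F(d) > 0 for all d > d^* (equivalently: artificial noise is the better technique for link distances below d^*, and the guard zone technique is better above d^*). -/

import Mathlib

open Real MeasureTheory Set

/-- The upper incomplete gamma function `Γ(a, b) = ∫_b^∞ t^(a-1) e^(-t) dt`. -/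
noncomputable def uGamma (a b : ℝ) : ℝ := ∫ t in Set.Ioi b, t ^ (a - 1) * Real.exp (-t)

theorem uGamma_int (a : ℝ) (ha : 0 < a) :
    IntegrableOn (fun t : ℝ => t ^ (a - 1) * Real.exp (-t)) (Set.Ioi 0) := by
  have h := Real.GammaIntegral_convergent ha
  simpa only [mul_comm] using h

theorem uGamma_ii (a : ℝ) (ha : 0 < a) (x y : ℝ) (hx : 0 ≤ x) (hxy : x ≤ y) :
    IntervalIntegrable (fun t : ℝ => t ^ (a - 1) * Real.exp (-t)) volume x y := by
  rw [intervalIntegrable_iff_integrableOn_Ioc_of_le hxy]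
  exact (uGamma_int a ha).mono_set (fun t ht => lt_of_le_of_lt hx ht.1)

theorem uGamma_sub (a : ℝ) (ha : 0 < a) (x y : ℝ) (hx : 0 ≤ x) (hxy : x ≤ y) :
    uGamma a x = (∫ t in x..y, t ^ (a - 1) * Real.exp (-t)) + uGamma a y := by
  unfold uGamma
  rw [intervalIntegral.integral_of_le hxy, ← setIntegral_union Ioc_disjoint_Ioi_same
    measurableSet_Ioi ((uGamma_int a ha).mono_set (fun t ht => lt_of_le_of_lt hx ht.1))
    ((uGamma_int a ha).mono_set (fun t ht => lt_of_le_of_lt (hx.trans hxy) ht)),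
    Ioc_union_Ioi_eq_Ioi hxy]

theorem uGamma_anti (a : ℝ) (ha : 0 < a) (x y : ℝ) (hx : 0 ≤ x) (hxy : x < y) :
    uGamma a y < uGamma a x := by
  rw [uGamma_sub a ha x y hx hxy.le]
  have : 0 < ∫ t in x..y, t ^ (a - 1) * Real.exp (-t) := by
    apply intervalIntegral.intervalIntegral_pos_of_pos_on (uGamma_ii a ha x y hx hxy.le) _ hxy
    intro t ht
    have : 0 < t := lt_of_le_of_lt hx ht.1
    positivity
  linarith

theorem uGamma_zero (a : ℝ) (ha : 0 < a) : uGamma a 0 = Real.Gamma a := by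
  rw [Real.Gamma_eq_integral ha]
  unfold uGamma
  simp only [mul_comm]

theorem uGamma_exists (a A : ℝ) (ha : 0 < a) (hA : 0 < A) (hA' : A < Real.Gamma a) :
    ∃ b : ℝ, 0 < b ∧ uGamma a b = A := by
  have ht := intervalIntegral_tendsto_integral_Ioi 0 (uGamma_int a ha) Filter.tendsto_id
  have h0 := uGamma_zero a ha
  change Filter.Tendsto _ _ (nhds (uGamma a 0)) at ht
  rw [h0] at ht
  have hev := ht.eventually (lt_mem_nhds (show Real.Gamma a - A < Real.Gamma a by linarith))
  obtain ⟨B, hB, hB0⟩ := (hev.and (Filter.eventually_ge_atTop (0 : ℝ))).exists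
  simp only [id] at hB
  have hc := intervalIntegral.continuousOn_primitive_interval'
    (uGamma_ii a ha 0 B le_rfl hB0) (left_mem_uIcc)
  rw [uIcc_of_le hB0] at hc
  obtain ⟨b, hb, hbe⟩ := intermediate_value_Icc hB0 hc
    (show Real.Gamma a - A ∈ _ from ⟨by simp; linarith, hB.le⟩)
  have hs := uGamma_sub a ha 0 b le_rfl hb.1
  simp only at hbe
  rw [hbe, h0] at hs
  have hbA : uGamma a b = A := by linarith
  refine ⟨b, lt_of_le_of_ne hb.1 ?_, hbA⟩
  rintro rfl
  linarith

/-- Existence and uniqueness of the crossover link distance `d^*`: for eavesdropper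
densities above `λ_e^*`, the selection function `F(d) = A − Γ(2/α, H(d))` has a unique
positive zero `d^*`, is negative below it (artificial noise is better) and positive above
it (the guard zone technique is better). Here `σS` and `σP` denote the noise powers
`σ_S²` and `σ_P²`, and `lamE` the eavesdropper density. -/
theorem crossover_distance_exists_unique (α Pt σS σP βe βt lamE ε A G : ℝ)
    (hα : 2 < α) (hPt : 0 < Pt) (hσS : 0 < σS) (hσP : 0 < σP) (hβe : 0 < βe)
    (hβt : 0 < βt) (hε : ε ∈ Set.Ioo (0 : ℝ) 1)
    (hlamE : lamE > α / (2 * π * Real.Gamma (2 / α)) * Real.log (1 / ε) *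
      (Pt / (σS * βe)) ^ (-(2 / α)))
    (hA : A = α * Real.log (1 / ε) / (2 * π * lamE * (Pt / (σS * βe)) ^ (2 / α)))
    (hG : G = βe / (1 + βe) *
      (1 + σS / Pt *
        (α * Real.log (1 / ε) / (2 * π * lamE * Real.Gamma (2 / α))) ^ (α / 2))) :
    ∃ dstar : ℝ, 0 < dstar ∧
      (A - uGamma (2 / α)
          (βe * σS / Pt *
            (βt * dstar ^ α * σP / (Pt * lamE * π) * (1 / G - 1)) ^ (α / 2)) = 0) ∧
      (∀ d : ℝ, 0 < d →
        A - uGamma (2 / α)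
            (βe * σS / Pt *
              (βt * d ^ α * σP / (Pt * lamE * π) * (1 / G - 1)) ^ (α / 2)) = 0 →
          d = dstar) ∧
      (∀ d : ℝ, 0 < d → d < dstar →
        A - uGamma (2 / α)
          (βe * σS / Pt *
            (βt * d ^ α * σP / (Pt * lamE * π) * (1 / G - 1)) ^ (α / 2)) < 0) ∧
      (∀ d : ℝ, dstar < d →
        A - uGamma (2 / α)
          (βe * σS / Pt *
            (βt * d ^ α * σP / (Pt * lamE * π) * (1 / G - 1)) ^ (α / 2)) > 0) := by
  have hα0 : 0 < α := by linarith
  have hL : 0 < Real.log (1 / ε) := Real.log_pos (by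
    rw [lt_div_iff₀ hε.1]; linarith [hε.2])
  have ha : 0 < 2 / α := by positivity
  have hΓ : 0 < Real.Gamma (2 / α) := Real.Gamma_pos_of_pos ha
  have hπ := Real.pi_pos
  generalize Real.log (1 / ε) = L at *
  have hQ0 : 0 < Pt / (σS * βe) := by positivity
  have hQp : 0 < (Pt / (σS * βe)) ^ (2 / α) := by positivity
  rw [Real.rpow_neg hQ0.le] at hlamE
  have hlam : 0 < lamE := lt_trans (by positivity) hlamE
  have key : α * L < 2 * π * lamE * Real.Gamma (2 / α) * (Pt / (σS * βe)) ^ (2 / α) := by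
    have h1 : α / (2 * π * Real.Gamma (2 / α)) * L * ((Pt / (σS * βe)) ^ (2 / α))⁻¹
      = α * L / (2 * π * Real.Gamma (2 / α) * (Pt / (σS * βe)) ^ (2 / α)) := by
      field_simp
    rw [h1, gt_iff_lt, div_lt_iff₀ (by positivity)] at hlamE
    linarith
  have hA0 : 0 < A := by rw [hA]; positivity
  have hA1 : A < Real.Gamma (2 / α) := by
    rw [hA, div_lt_iff₀ (by positivity)]; linarith
  have hG0 : 0 < G := by rw [hG]; positivity
  have hG1 : G < 1 := by
    have hX : α * L / (2 * π * lamE * Real.Gamma (2 / α)) < (Pt / (σS * βe)) ^ (2 / α) := by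
      rw [div_lt_iff₀ (by positivity)]; linarith
    have h2 := Real.rpow_lt_rpow (by positivity) hX (show 0 < α / 2 by positivity)
    rw [← Real.rpow_mul hQ0.le, show 2 / α * (α / 2) = 1 by field_simp, Real.rpow_one] at h2
    have h3 := mul_lt_mul_of_pos_left h2 (show 0 < σS / Pt by positivity)
    have h4 : σS / Pt * (Pt / (σS * βe)) = 1 / βe := by field_simp
    rw [h4] at h3
    rw [hG]
    calc _ < βe / (1 + βe) * (1 + 1 / βe) := by gcongr
      _ = 1 := by field_simp; ring
  have hg : 0 < 1 / G - 1 := by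
    have := one_lt_one_div hG0 hG1
    linarith
  generalize 1 / G - 1 = g at *
  obtain ⟨b, hb, hbA⟩ := uGamma_exists (2 / α) A ha hA0 hA1
  let H : ℝ → ℝ := fun d => βe * σS / Pt * (βt * d ^ α * σP / (Pt * lamE * π) * g) ^ (α / 2)
  have hmono : ∀ x y : ℝ, 0 < x → x < y → H x < H y := by
    intro x y hx hxy
    have := Real.rpow_lt_rpow hx.le hxy hα0
    simp only [H]
    gcongr
  have hpos : ∀ x : ℝ, 0 < x → 0 ≤ H x := by
    intro x hx
    simp only [H]
    positivity
  let D : ℝ := ((b / (βe * σS / Pt)) ^ (2 / α) * (Pt * lamE * π) / (βt * σP * g)) ^ (1 / α)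
  have hD : 0 < D := by simp only [D]; positivity
  have hHD : H D = b := by
    have e1 : D ^ α = (b / (βe * σS / Pt)) ^ (2 / α) * (Pt * lamE * π) / (βt * σP * g) := by
      simp only [D]
      rw [← Real.rpow_mul (by positivity), show 1 / α * α = 1 by field_simp, Real.rpow_one]
    have e2 : βt * D ^ α * σP / (Pt * lamE * π) * g = (b / (βe * σS / Pt)) ^ (2 / α) := by
      rw [e1]
      generalize (b / (βe * σS / Pt)) ^ (2 / α) = z
      field_simp
    simp only [H]
    rw [e2, ← Real.rpow_mul (by positivity), show 2 / α * (α / 2) = 1 by field_simp,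
      Real.rpow_one]
    field_simp
  have hlt : ∀ d : ℝ, 0 < d → d < D → A - uGamma (2 / α) (H d) < 0 := by
    intro d hd hdD
    have := uGamma_anti (2 / α) ha _ _ (hpos d hd) (hmono d D hd hdD)
    rw [hHD, hbA] at this
    linarith
  have hgt : ∀ d : ℝ, D < d → A - uGamma (2 / α) (H d) > 0 := by
    intro d hdD
    have := uGamma_anti (2 / α) ha _ _ (hpos D hD) (hmono D d hD hdD)
    rw [hHD, hbA] at this
    linarith
  refine ⟨D, hD, ?_, ?_, hlt, hgt⟩
  · change A - uGamma (2 / α) (H D) = 0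
    rw [hHD, hbA, sub_self]
  · intro d hd h
    change A - uGamma (2 / α) (H d) = 0 at h
    rcases lt_trichotomy d D with h1 | h1 | h1
    · linarith [hlt d hd h1]
    · exact h1
    · linarith [hgt d h1]
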